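/- Under the uniform local ℓ_p stability assumption and the stated conditions on α and γ, let X ⊆ ℝ^n be a nonempty compact set with X ∩ ∂D̃ ≠ ∅, and let (X_k)_{k∈ℤ≥0} be a sequence of nonempty compact sets converging to X in the symmetric Hausdorff distance. Then V(X_k) → ∞ as k → ∞. -/

import Mathlib

open Metric Set Filter Topology TopologicalSpace ENNReal

noncomputable section

abbrev Euc (n : ℕ) : Type := EuclideanSpace ℝ (Fin n)

/-- Trajectory of the discrete-time uncertain system `x_{k+1} = f (x_k) (w_k)`. -/
def traj {n m : ℕ} (f : Euc n → Euc m → Euc n) (x : Euc n) (π : ℕ → Euc m) : ℕ → Euc n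
  | 0 => x
  | k + 1 => f (traj f x π k) (π k)

/-- Reachable set of `X` at time `k` under disturbance signals taking values in `W`. -/
def reach {n m : ℕ} (f : Euc n → Euc m → Euc n) (W : Set (Euc m)) (X : Set (Euc n)) (k : ℕ) :
    Set (Euc n) :=
  {y | ∃ x ∈ X, ∃ π : ℕ → Euc m, (∀ j, π j ∈ W) ∧ y = traj f x π k}

/-- The one-step set-valued map `F(X) = {f x w : x ∈ X, w ∈ W}`. -/
def Fmap {n m : ℕ} (f : Euc n → Euc m → Euc n) (W : Set (Euc m)) (X : Set (Euc n)) :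
    Set (Euc n) :=
  Set.image2 f X W

/-- Asymmetric (directed) Hausdorff distance `sup_{x ∈ A} dist(x, B)`. -/
def dHa {n : ℕ} (A B : Set (Euc n)) : ℝ := ⨆ x : A, Metric.infDist (x : Euc n) B

/-- Uniform local ℓ_p stability of the robust invariant set `𝒜` within the safe set `𝒳`. -/
structure LpStable {n m : ℕ} (f : Euc n → Euc m → Euc n) (W : Set (Euc m))
    (𝒳 𝒜 : Set (Euc n)) where
  r : ℝ
  M : ℝ
  p : ℝ
  lam : ℝ → ℕ → ℝ
  r_pos : 0 < r
  M_ge_one : 1 ≤ M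
  p_pos : 0 < p
  lam_nonneg : ∀ s ∈ Set.Icc (0 : ℝ) r, ∀ k : ℕ, 0 ≤ lam s k
  lam_cont : ∀ k : ℕ, ContinuousOn (fun s => lam s k) (Set.Icc (0 : ℝ) r)
  lam_mono : ∀ k : ℕ, MonotoneOn (fun s => lam s k) (Set.Icc (0 : ℝ) r)
  lam_zero : ∀ k : ℕ, lam 0 k = 0
  lam_anti : ∀ s ∈ Set.Icc (0 : ℝ) r, ∀ k l : ℕ, k ≤ l → lam s l ≤ lam s k
  lam_le_id : ∀ s ∈ Set.Icc (0 : ℝ) r, lam s 0 ≤ s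
  lam_summable : Summable fun k : ℕ => lam r k ^ p
  stab : ∀ x ∈ 𝒳, Metric.infDist x 𝒜 ≤ r →
    ∀ π : ℕ → Euc m, (∀ j, π j ∈ W) →
      ∀ k : ℕ, Metric.infDist (traj f x π k) 𝒜 ≤ M * lam (Metric.infDist x 𝒜) k

/-- The safe robust domain of uniform attraction. -/
def DOUA {n m : ℕ} (f : Euc n → Euc m → Euc n) (W : Set (Euc m)) (𝒳 𝒜 : Set (Euc n)) :
    Set (Euc n) :=
  {x | (∀ k : ℕ, reach f W {x} k ⊆ 𝒳) ∧
    Filter.Tendsto (fun k => dHa (reach f W {x} k) 𝒜) Filter.atTop (nhds 0)}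

/-- The safe robust domain of attraction. -/
def DOA {n m : ℕ} (f : Euc n → Euc m → Euc n) (W : Set (Euc m)) (𝒳 𝒜 : Set (Euc n)) :
    Set (Euc n) :=
  {x | ∀ π : ℕ → Euc m, (∀ j, π j ∈ W) →
    (∀ k : ℕ, traj f x π k ∈ 𝒳) ∧
      Filter.Tendsto (fun k => Metric.infDist (traj f x π k) 𝒜) Filter.atTop (nhds 0)}

/-- `Ψ(X) = (sup_{y∈X} γ y) * (sup_{y∈X} α y)`. -/
def Psi {n : ℕ} (α : Euc n → ℝ) (γ : Euc n → ℝ≥0∞) (X : Set (Euc n)) : ℝ≥0∞ :=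
  (⨆ y : X, γ (y : Euc n)) * ENNReal.ofReal (⨆ y : X, α (y : Euc n))

/-- The value function `V(X) = Σ_k Ψ(R(X,k))`. -/
def Vval {n m : ℕ} (f : Euc n → Euc m → Euc n) (W : Set (Euc m)) (α : Euc n → ℝ)
    (γ : Euc n → ℝ≥0∞) (X : Set (Euc n)) : ℝ≥0∞ :=
  ∑' k : ℕ, Psi α γ (reach f W X k)

/-- `exp(-a)` for `a ∈ [0,∞]`, with `exp(-∞) = 0`. -/
def expNeg (a : ℝ≥0∞) : ℝ := if a = ⊤ then 0 else Real.exp (-a.toReal)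

/-- The value function `W(X) = 1 - exp(-V(X))`. -/
def Wval {n m : ℕ} (f : Euc n → Euc m → Euc n) (W : Set (Euc m)) (α : Euc n → ℝ)
    (γ : Euc n → ℝ≥0∞) (X : Set (Euc n)) : ℝ :=
  1 - expNeg (Vval f W α γ X)

/-- `ξ(X) = 1 - exp(-Ψ(X))`. -/
def xival {n : ℕ} (α : Euc n → ℝ) (γ : Euc n → ℝ≥0∞) (X : Set (Euc n)) : ℝ :=
  1 - expNeg (Psi α γ X)

/-- `β(X) = exp(Ψ(X)) - 1`. -/
def betaval {n : ℕ} (α : Euc n → ℝ) (γ : Euc n → ℝ≥0∞) (X : Set (Euc n)) : ℝ :=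
  Real.exp ((Psi α γ X).toReal) - 1

/-- Conditions on `α`: continuous with `α̲ dist(x,𝒜)^p̄ ≤ α(x) ≤ ᾱ dist(x,𝒜)^p̄`. -/
def AlphaHyp {n : ℕ} (𝒜 : Set (Euc n)) (α : Euc n → ℝ) (αlow αup pbar : ℝ) : Prop :=
  Continuous α ∧ 0 < αlow ∧ αlow ≤ αup ∧
    ∀ x : Euc n, αlow * Metric.infDist x 𝒜 ^ pbar ≤ α x ∧
      α x ≤ αup * Metric.infDist x 𝒜 ^ pbar

/-- Conditions on `γ`: finite, continuous and `≥ γ̲ > 0` on `𝒳`, `= ∞` outside `𝒳`,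
blowing up along sequences converging to the boundary of `𝒳`. -/
def GammaHyp {n : ℕ} (𝒳 : Set (Euc n)) (γ : Euc n → ℝ≥0∞) (γlow : ℝ) : Prop :=
  (∀ x ∈ 𝒳, γ x ≠ ⊤) ∧ ContinuousOn γ 𝒳 ∧ 0 < γlow ∧
    (∀ x ∈ 𝒳, ENNReal.ofReal γlow ≤ γ x) ∧
    (∀ x ∉ 𝒳, γ x = ⊤) ∧
    ∀ (u : ℕ → Euc n) (x : Euc n), x ∈ frontier 𝒳 →
      Filter.Tendsto u Filter.atTop (nhds x) →
      Filter.Tendsto (fun k => γ (u k)) Filter.atTop (nhds ⊤)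


theorem traj_cont {n m : ℕ} (f : Euc n → Euc m → Euc n)
    (hf : Continuous fun p : Euc n × Euc m => f p.1 p.2) (k : ℕ) :
    Continuous fun q : Euc n × (ℕ → Euc m) => traj f q.1 q.2 k := by
  induction k with
  | zero => exact continuous_fst
  | succ k ih =>
    exact hf.comp (ih.prodMk ((continuous_apply k).comp continuous_snd))

theorem traj_shift {n m : ℕ} (f : Euc n → Euc m → Euc n) (x : Euc n) (π : ℕ → Euc m) (N k : ℕ) :
    traj f x π (N + k) = traj f (traj f x π N) (fun j => π (N + j)) k := by
  induction k with
  | zero => rfl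
  | succ k ih =>
    change f (traj f x π (N + k)) (π (N + k)) = _
    rw [ih]; rfl

theorem sig_compact {m : ℕ} {Wd : Set (Euc m)} (hWc : IsCompact Wd) :
    IsCompact {π : ℕ → Euc m | ∀ j, π j ∈ Wd} := by
  have := isCompact_univ_pi (fun _ : ℕ => hWc)
  convert this using 1
  ext π; simp

theorem reach_compact {n m : ℕ} (f : Euc n → Euc m → Euc n)
    (hf : Continuous fun p : Euc n × Euc m => f p.1 p.2) {Wd : Set (Euc m)} (hWc : IsCompact Wd)
    {X : Set (Euc n)} (hX : IsCompact X) (k : ℕ) : IsCompact (reach f Wd X k) := by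
  convert (hX.prod (sig_compact hWc)).image (traj_cont f hf k) using 1
  ext y
  constructor
  · rintro ⟨x, hx, π, hπ, rfl⟩
    exact ⟨(x, π), ⟨hx, hπ⟩, rfl⟩
  · rintro ⟨⟨x, π⟩, ⟨hx, hπ⟩, rfl⟩
    exact ⟨x, hx, π, hπ, rfl⟩

theorem Psi_ge {n : ℕ} {α : Euc n → ℝ} (hα : Continuous α) (γ : Euc n → ℝ≥0∞) {S : Set (Euc n)}
    (hS : IsCompact S) {y : Euc n} (hy : y ∈ S) :
    γ y * ENNReal.ofReal (α y) ≤ Psi α γ S := by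
  unfold Psi
  have hb : BddAbove (Set.range fun y : S => α (y : Euc n)) := by
    have := (hS.image hα).bddAbove
    rwa [Set.image_eq_range] at this
  exact mul_le_mul' (le_iSup (fun y : S => γ (y : Euc n)) ⟨y, hy⟩)
    (ENNReal.ofReal_le_ofReal (le_ciSup hb ⟨y, hy⟩))

theorem lam_tendsto {n m : ℕ} {f : Euc n → Euc m → Euc n} {Wd : Set (Euc m)}
    {𝒳 𝒜 : Set (Euc n)} (H : LpStable f Wd 𝒳 𝒜) :
    Tendsto (fun k => H.M * H.lam H.r k) atTop (𝓝 0) := by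
  have h1 := H.lam_summable.tendsto_atTop_zero
  have h2 := h1.rpow_const (p := H.p⁻¹) (Or.inr (inv_nonneg.2 H.p_pos.le))
  rw [Real.zero_rpow (inv_ne_zero H.p_pos.ne')] at h2
  have h3 : Tendsto (fun k => H.lam H.r k) atTop (𝓝 0) := by
    refine h2.congr fun k => ?_
    rw [← Real.rpow_mul (H.lam_nonneg _ ⟨H.r_pos.le, le_rfl⟩ k), mul_inv_cancel₀ H.p_pos.ne',
      Real.rpow_one]
  simpa using h3.const_mul H.M

theorem dHa_tendsto {n m : ℕ} {f : Euc n → Euc m → Euc n} {Wd : Set (Euc m)}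
    {𝒳 𝒜 : Set (Euc n)} (H : LpStable f Wd 𝒳 𝒜) (x : Euc n) (N : ℕ)
    (h1 : ∀ π : ℕ → Euc m, (∀ j, π j ∈ Wd) → traj f x π N ∈ 𝒳)
    (h2 : ∀ π : ℕ → Euc m, (∀ j, π j ∈ Wd) → infDist (traj f x π N) 𝒜 ≤ H.r) :
    Tendsto (fun k => dHa (reach f Wd {x} k) 𝒜) atTop (𝓝 0) := by
  rw [← tendsto_add_atTop_iff_nat N]
  refine squeeze_zero (fun k => Real.iSup_nonneg fun _ => infDist_nonneg) (fun k => ?_)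
    (lam_tendsto H)
  have h0 : 0 ≤ H.lam H.r k := H.lam_nonneg _ ⟨H.r_pos.le, le_rfl⟩ k
  have hM : 0 ≤ H.M := zero_le_one.trans H.M_ge_one
  refine Real.iSup_le ?_ (mul_nonneg hM h0)
  rintro ⟨y, x', rfl, π, hπ, rfl⟩
  simp only
  rw [add_comm k N, traj_shift]
  refine (H.stab _ (h1 π hπ) (h2 π hπ) _ (fun j => hπ _) k).trans ?_
  exact mul_le_mul_of_nonneg_left
    (H.lam_mono k ⟨infDist_nonneg, h2 π hπ⟩ ⟨H.r_pos.le, le_rfl⟩ (h2 π hπ)) hM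

theorem DOUA_open {n m : ℕ}
    (f : Euc n → Euc m → Euc n) (hf : Continuous fun p : Euc n × Euc m => f p.1 p.2)
    (Wd : Set (Euc m)) (hWc : IsCompact Wd)
    (𝒳 : Set (Euc n)) (h𝒳 : IsOpen 𝒳)
    (𝒜 : Set (Euc n)) (h𝒜ne : 𝒜.Nonempty) (h𝒜c : IsCompact 𝒜) (h𝒜𝒳 : 𝒜 ⊆ 𝒳)
    (H : LpStable f Wd 𝒳 𝒜) : IsOpen (DOUA f Wd 𝒳 𝒜) := by
  rw [isOpen_iff_mem_nhds]
  rintro x ⟨hx1, hx2⟩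
  obtain ⟨δ, hδ, hδs⟩ := h𝒜c.exists_cthickening_subset_open h𝒳 h𝒜𝒳
  have hM : 0 < H.M := zero_lt_one.trans_le H.M_ge_one
  set r' := min H.r (δ / H.M) with hr'
  have hr'0 : 0 < r' := lt_min H.r_pos (div_pos hδ hM)
  obtain ⟨N, hN⟩ := (hx2.eventually (gt_mem_nhds hr'0)).exists
  have hN' : ∀ π ∈ {π : ℕ → Euc m | ∀ j, π j ∈ Wd}, infDist (traj f x π N) 𝒜 < r' := by
    intro π hπ
    refine lt_of_le_of_lt ?_ hN
    have hb : BddAbove (Set.range fun y : reach f Wd {x} N => infDist (y : Euc n) 𝒜) := by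
      have := ((reach_compact f hf hWc (isCompact_singleton (x := x)) N).image
        (continuous_infDist_pt 𝒜)).bddAbove
      rwa [Set.image_eq_range] at this
    exact le_ciSup hb ⟨traj f x π N, x, rfl, π, hπ, rfl⟩
  have e1 : ∀ᶠ y in 𝓝 x, ∀ π ∈ {π : ℕ → Euc m | ∀ j, π j ∈ Wd},
      infDist (traj f y π N) 𝒜 < r' := by
    refine (sig_compact hWc).eventually_forall_of_forall_eventually fun π hπ => ?_
    have hc : Continuous fun q : Euc n × (ℕ → Euc m) => infDist (traj f q.1 q.2 N) 𝒜 :=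
      (continuous_infDist_pt 𝒜).comp (traj_cont f hf N)
    exact (isOpen_lt hc continuous_const).mem_nhds (hN' π hπ)
  have e2 : ∀ᶠ y in 𝓝 x, ∀ j ∈ Finset.range (N + 1), ∀ π ∈ {π : ℕ → Euc m | ∀ j, π j ∈ Wd},
      traj f y π j ∈ 𝒳 := by
    rw [Filter.eventually_all_finset]
    intro j _
    refine (sig_compact hWc).eventually_forall_of_forall_eventually fun π hπ => ?_
    exact (h𝒳.preimage (traj_cont f hf j)).mem_nhds
      (hx1 j ⟨x, rfl, π, hπ, rfl⟩ : traj f x π j ∈ 𝒳)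
  filter_upwards [e1, e2] with y h1 h2
  have hle : ∀ π : ℕ → Euc m, (∀ j, π j ∈ Wd) → infDist (traj f y π N) 𝒜 ≤ H.r := fun π hπ =>
    (h1 π hπ).le.trans (min_le_left _ _)
  have hin : ∀ π : ℕ → Euc m, (∀ j, π j ∈ Wd) → traj f y π N ∈ 𝒳 := fun π hπ =>
    h2 N (by simp) π hπ
  refine ⟨?_, dHa_tendsto H y N hin hle⟩
  rintro k _ ⟨_, rfl, π, hπ, rfl⟩
  rcases le_total k N with hk | hk
  · exact h2 k (by simp; omega) π hπ
  · obtain ⟨l, rfl⟩ := Nat.exists_eq_add_of_le hk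
    apply hδs
    rw [mem_cthickening_iff, ENNReal.le_ofReal_iff_toReal_le (infEDist_ne_top h𝒜ne) hδ.le]
    rw [traj_shift]
    have hs : infDist (traj f _ π N) 𝒜 ∈ Set.Icc (0 : ℝ) H.r := ⟨infDist_nonneg, hle π hπ⟩
    calc _ ≤ _ := H.stab _ (hin π hπ) (hle π hπ) _ (fun j => hπ _) l
      _ ≤ H.M * (δ / H.M) := by
        refine mul_le_mul_of_nonneg_left ?_ hM.le
        exact ((H.lam_anti _ hs 0 l (Nat.zero_le _)).trans (H.lam_le_id _ hs)).trans
          ((h1 π hπ).le.trans (min_le_right _ _))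
      _ = δ := by field_simp

theorem stmt11 {n m : ℕ}
    (f : Euc n → Euc m → Euc n) (hf : Continuous fun p : Euc n × Euc m => f p.1 p.2)
    (Wd : Set (Euc m)) (hWne : Wd.Nonempty) (hWc : IsCompact Wd)
    (𝒳 : Set (Euc n)) (h𝒳 : IsOpen 𝒳)
    (𝒜 : Set (Euc n)) (h𝒜ne : 𝒜.Nonempty) (h𝒜c : IsCompact 𝒜) (h𝒜𝒳 : 𝒜 ⊆ 𝒳)
    (h𝒜inv : ∀ x ∈ 𝒜, ∀ w ∈ Wd, f x w ∈ 𝒜)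
    (H : LpStable f Wd 𝒳 𝒜)
    (α : Euc n → ℝ) (αlow αup pbar : ℝ) (hα : AlphaHyp 𝒜 α αlow αup pbar)
    (hpbar : H.p ≤ pbar)
    (γ : Euc n → ℝ≥0∞) (γlow : ℝ) (hγ : GammaHyp 𝒳 γ γlow)
    (X : NonemptyCompacts (Euc n))
    (hX : ((X : Set (Euc n)) ∩ frontier (DOUA f Wd 𝒳 𝒜)).Nonempty)
    (Xs : ℕ → NonemptyCompacts (Euc n)) (hXs : Filter.Tendsto Xs Filter.atTop (nhds X)) :
    Filter.Tendsto (fun k => Vval f Wd α γ (Xs k : Set (Euc n))) Filter.atTop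
      (nhds (⊤ : ℝ≥0∞)) := by
  obtain ⟨x, hxX, hxF⟩ := hX
  obtain ⟨hαc, hαl, -, hαb⟩ := hα
  obtain ⟨-, -, hγl, hγge, hγtop, hγbd⟩ := hγ
  have hpb : 0 < pbar := H.p_pos.trans_le hpbar
  have hopen := DOUA_open f hf Wd hWc 𝒳 h𝒳 𝒜 h𝒜ne h𝒜c h𝒜𝒳 H
  have hxD : x ∉ DOUA f Wd 𝒳 𝒜 := by
    rw [hopen.frontier_eq] at hxF; exact hxF.2
  have hγge' : ∀ y, ENNReal.ofReal γlow ≤ γ y := fun y => by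
    by_cases hy : y ∈ 𝒳
    · exact hγge y hy
    · rw [hγtop y hy]; exact le_top
  -- reduction to a neighborhood statement
  suffices key : ∀ C : ℝ≥0∞, C < ⊤ → ∀ᶠ y in 𝓝 x, ∀ S : Set (Euc n), IsCompact S → y ∈ S →
      C < Vval f Wd α γ S by
    refine tendsto_order.2 ⟨fun C hC => ?_, fun C hC => absurd hC not_top_lt⟩
    obtain ⟨ε, hε, hball⟩ := Metric.eventually_nhds_iff.1 (key C hC)
    have := (tendsto_iff_dist_tendsto_zero.1 hXs).eventually (gt_mem_nhds hε)
    filter_upwards [this] with k hk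
    rw [dist_comm, NonemptyCompacts.dist_eq] at hk
    obtain ⟨y, hy, hxy⟩ := exists_dist_lt_of_hausdorffDist_lt hxX hk
      (hausdorffEDist_ne_top_of_nonempty_of_bounded X.nonempty (Xs k).nonempty
        X.isCompact.isBounded (Xs k).isCompact.isBounded)
    exact hball (by rwa [dist_comm]) _ (Xs k).isCompact hy
  intro C hC
  by_cases hsafe : ∀ k, reach f Wd {x} k ⊆ 𝒳
  · -- no convergence
    have hfar : ∀ j, ∃ π : ℕ → Euc m, (∀ i, π i ∈ Wd) ∧ H.r < infDist (traj f x π j) 𝒜 := by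
      intro j
      by_contra! hcon
      exact hxD ⟨hsafe, dHa_tendsto H x j (fun π hπ => hsafe j ⟨x, rfl, π, hπ, rfl⟩) hcon⟩
    choose P hP hfar using hfar
    set c : ℝ≥0∞ := ENNReal.ofReal γlow * ENNReal.ofReal (αlow * H.r ^ pbar) with hc
    have hc0 : c ≠ 0 := by
      have : 0 < αlow * H.r ^ pbar := mul_pos hαl (Real.rpow_pos_of_pos H.r_pos _)
      simp [hc, hγl, this]
    obtain ⟨N, hN⟩ := ENNReal.exists_nat_mul_gt hc0 hC.ne
    have ev : ∀ᶠ y in 𝓝 x, ∀ j ∈ Finset.range N, H.r < infDist (traj f y (P j) j) 𝒜 := by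
      rw [Filter.eventually_all_finset]
      intro j _
      have hc : Continuous fun y : Euc n => infDist (traj f y (P j) j) 𝒜 :=
        (continuous_infDist_pt 𝒜).comp ((traj_cont f hf j).comp
          (Continuous.prodMk continuous_id (continuous_const (y := P j))))
      exact (isOpen_lt continuous_const hc).mem_nhds (hfar j)
    filter_upwards [ev] with y hy S hS hyS
    calc C < N * c := hN
      _ = ∑ j ∈ Finset.range N, c := by simp
      _ ≤ ∑ j ∈ Finset.range N, Psi α γ (reach f Wd S j) := by
        refine Finset.sum_le_sum fun j hj => ?_
        refine le_trans ?_ (Psi_ge hαc γ (reach_compact f hf hWc hS j)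
          (y := traj f y (P j) j) ⟨y, hyS, P j, hP j, rfl⟩)
        refine mul_le_mul' (hγge' _) (ENNReal.ofReal_le_ofReal (le_trans ?_ (hαb _).1))
        exact mul_le_mul_of_nonneg_left
          (Real.rpow_le_rpow H.r_pos.le (hy j hj).le hpb.le) hαl.le
      _ ≤ _ := ENNReal.sum_le_tsum _
  · push Not at hsafe
    obtain ⟨j, hj⟩ := hsafe
    obtain ⟨z, ⟨x', hx', π, hπ, hz⟩, hzX⟩ := Set.not_subset.1 hj
    rw [Set.mem_singleton_iff] at hx'
    subst hx'
    have hγz : Tendsto γ (𝓝 z) (𝓝 ⊤) := by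
      by_cases hcl : z ∈ closure 𝒳
      · exact tendsto_of_seq_tendsto fun u hu =>
          hγbd u z (by rw [h𝒳.frontier_eq]; exact ⟨hcl, hzX⟩) hu
      · refine tendsto_const_nhds.congr' ?_
        filter_upwards [isClosed_closure.isOpen_compl.mem_nhds hcl] with y hy
        exact (hγtop y fun h => hy (subset_closure h)).symm
    have hαz : 0 < α z := by
      have : 0 < infDist z 𝒜 :=
        (h𝒜c.isClosed.notMem_iff_infDist_pos h𝒜ne).1 fun h => hzX (h𝒜𝒳 h)
      exact lt_of_lt_of_le (mul_pos hαl (Real.rpow_pos_of_pos this _)) (hαb z).1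
    have hprod : Tendsto (fun y => γ y * ENNReal.ofReal (α y)) (𝓝 z) (𝓝 ⊤) := by
      have h0 : ENNReal.ofReal (α z) ≠ 0 := by simpa using hαz
      have := ENNReal.Tendsto.mul hγz (Or.inl ENNReal.top_ne_zero)
        (ENNReal.tendsto_ofReal hαc.continuousAt) (Or.inl h0)
      rwa [ENNReal.top_mul h0] at this
    have ht : Tendsto (fun y => traj f y π j) (𝓝 x') (𝓝 z) := by
      rw [hz]
      exact ((traj_cont f hf j).comp
        (Continuous.prodMk continuous_id (continuous_const (y := π)))).continuousAt
    filter_upwards [(hprod.comp ht).eventually (lt_mem_nhds hC)] with y hy S hS hyS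
    calc C < _ := hy
      _ ≤ Psi α γ (reach f Wd S j) := Psi_ge hαc γ (reach_compact f hf hWc hS j)
          (y := traj f y π j) ⟨y, hyS, π, hπ, rfl⟩
      _ ≤ _ := ENNReal.le_tsum j

end
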